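/- arXiv:2302.07705 — 3 statements merged into one kernel-verified Lean document; each statement's English description precedes it below -/
import Mathlib

section
/- Let m be an integer and let z ∈ ℂ with Im z < 0. Then the function s ↦ e^{i m (z+s)}/(z+s)³ is integrable on ℝ, and ∫_{−∞}^{∞} e^{i m (z+s)}/(z+s)³ ds = −iπm² if m > 0, and = 0 if m ≤ 0. -/
open MeasureTheory

/-- The inverse Fourier kernel of the cubed resolvent: the function `t² e^{-yt}` on `t > 0`,
extended by zero. -/
noncomputable def cubeKernel (y : ℝ) (t : ℝ) : ℂ :=
  ((max t 0 ^ 2 * Real.exp (-y * t) : ℝ) : ℂ)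

theorem cubeKernel_eq_indicator (y : ℝ) :
    cubeKernel y = (Set.Ioi (0 : ℝ)).indicator
      (fun t : ℝ => ((t ^ 2 * Real.exp (-y * t) : ℝ) : ℂ)) := by
  ext t
  by_cases ht : 0 < t
  · simp [cubeKernel, Set.indicator_of_mem (Set.mem_Ioi.2 ht), max_eq_left ht.le]
  · simp [cubeKernel, ht, max_eq_right (not_lt.1 ht)]

theorem continuous_cubeKernel (y : ℝ) : Continuous (cubeKernel y) := by
  unfold cubeKernel
  fun_prop

theorem integrable_cubeKernel {y : ℝ} (hy : 0 < y) : Integrable (cubeKernel y) := by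
  rw [cubeKernel_eq_indicator, integrable_indicator_iff measurableSet_Ioi]
  have h := integrableOn_rpow_mul_exp_neg_mul_rpow (p := 1) (s := 2) (b := y)
    (by norm_num) one_pos hy
  simp only [Real.rpow_one, Real.rpow_ofNat] at h
  exact h.ofReal

theorem norm_exp_neg_mul_ofReal (r : ℂ) (t : ℝ) :
    ‖Complex.exp (-r * t)‖ = Real.exp (-r.re * t) := by
  simp [Complex.norm_exp]

theorem tendsto_pow_mul_cexp_neg_mul_atTop {r : ℂ} (hr : 0 < r.re) (n : ℕ) :
    Filter.Tendsto (fun t : ℝ => (t : ℂ) ^ n * Complex.exp (-r * t)) Filter.atTop (nhds 0) := by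
  rw [tendsto_zero_iff_norm_tendsto_zero]
  refine (tendsto_rpow_mul_exp_neg_mul_atTop_nhds_zero n r.re hr).congr' ?_
  filter_upwards [Filter.eventually_ge_atTop 0] with t ht
  rw [norm_mul, norm_exp_neg_mul_ofReal, norm_pow, Complex.norm_of_nonneg ht, Real.rpow_natCast]

theorem integral_sq_mul_cexp_neg_mul_Ioi {r : ℂ} (hr : 0 < r.re) :
    ∫ t in Set.Ioi (0 : ℝ), (t : ℂ) ^ 2 * Complex.exp (-r * t) = 2 / r ^ 3 := by
  have hr0 : r ≠ 0 := fun h => by simp [h] at hr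
  have hint : IntegrableOn (fun t : ℝ => (t : ℂ) ^ 2 * Complex.exp (-r * t)) (Set.Ioi 0) := by
    have h := integrableOn_rpow_mul_exp_neg_mul_rpow (p := 1) (s := 2) (b := r.re)
      (by norm_num) one_pos hr
    simp only [Real.rpow_one, Real.rpow_ofNat] at h
    refine h.mono' (Measurable.aestronglyMeasurable (by fun_prop)) (.of_forall fun t => ?_)
    simp [norm_exp_neg_mul_ofReal, -neg_mul]
  have hderiv (t : ℝ) : HasDerivAt
      (fun t : ℝ => -(1 / r) * ((t : ℂ) ^ 2 * Complex.exp (-r * t)) +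
        -(2 / r ^ 2) * ((t : ℂ) ^ 1 * Complex.exp (-r * t)) +
        -(2 / r ^ 3) * ((t : ℂ) ^ 0 * Complex.exp (-r * t)))
      ((t : ℂ) ^ 2 * Complex.exp (-r * t)) t := by
    have hid : HasDerivAt (fun t : ℝ => (t : ℂ)) 1 t := Complex.ofRealCLM.hasDerivAt
    have hexp := (hid.const_mul (-r)).cexp
    refine HasDerivAt.congr_deriv (((((hid.fun_pow 2).mul hexp).const_mul (-(1 / r))).add
      (((hid.fun_pow 1).mul hexp).const_mul (-(2 / r ^ 2)))).add
      (((hid.fun_pow 0).mul hexp).const_mul (-(2 / r ^ 3)))) ?_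
    simp
    field_simp
    ring
  have hlim := (((tendsto_pow_mul_cexp_neg_mul_atTop hr 2).const_mul (-(1 / r))).add
    ((tendsto_pow_mul_cexp_neg_mul_atTop hr 1).const_mul (-(2 / r ^ 2)))).add
    ((tendsto_pow_mul_cexp_neg_mul_atTop hr 0).const_mul (-(2 / r ^ 3)))
  rw [integral_Ioi_of_hasDerivAt_of_tendsto' (fun t _ => hderiv t) hint hlim]
  simp

open scoped FourierTransform in
theorem fourier_cubeKernel {y : ℝ} (hy : 0 < y) (w : ℝ) :
    𝓕 (cubeKernel y) w = 2 / ((y : ℂ) + Complex.I * (2 * Real.pi * w : ℝ)) ^ 3 := by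
  rw [← integral_sq_mul_cexp_neg_mul_Ioi (by simpa using hy),
    Real.fourier_real_eq_integral_exp_smul, cubeKernel_eq_indicator,
    ← integral_indicator measurableSet_Ioi]
  congr 1 with t
  rw [← Set.indicator_smul_apply (Set.Ioi 0)
    (fun v : ℝ => Complex.exp ((-2 * Real.pi * v * w : ℝ) * Complex.I))]
  congr 1
  ext v
  push_cast
  rw [smul_eq_mul, mul_left_comm, ← Complex.exp_add]
  congr 2
  ring

theorem integrable_inv_cube {y : ℝ} (hy : 0 < y) :
    Integrable (fun s : ℝ => (((y : ℂ) + Complex.I * s) ^ 3)⁻¹) := by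
  have hre (s : ℝ) : ((y : ℂ) + Complex.I * s).re = y := by simp
  have hne (s : ℝ) : (y : ℂ) + Complex.I * s ≠ 0 := fun h => by
    have := hre s
    rw [h] at this
    simp at this
    linarith
  have hc : 0 < y * min 1 (y ^ 2) := by positivity
  refine (integrable_inv_one_add_sq.const_mul (y * min 1 (y ^ 2))⁻¹).mono'
    (Continuous.aestronglyMeasurable ?_) (.of_forall fun s => ?_)
  · exact Continuous.inv₀ (by fun_prop) fun s => pow_ne_zero 3 (hne s)
  · rw [norm_inv, norm_pow, ← mul_inv]
    refine inv_anti₀ (by positivity) ?_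
    have h1 : y ≤ ‖(y : ℂ) + Complex.I * s‖ := by
      simpa [abs_of_pos hy] using Complex.abs_re_le_norm ((y : ℂ) + Complex.I * s)
    have h2 : ‖(y : ℂ) + Complex.I * s‖ ^ 2 = y ^ 2 + s ^ 2 := by
      rw [← Complex.normSq_eq_norm_sq, Complex.normSq_apply]
      simp
      ring
    have h3 : min 1 (y ^ 2) * (1 + s ^ 2) ≤ y ^ 2 + s ^ 2 := by
      nlinarith [min_le_left 1 (y ^ 2), min_le_right 1 (y ^ 2), sq_nonneg s]
    calc y * min 1 (y ^ 2) * (1 + s ^ 2) = y * (min 1 (y ^ 2) * (1 + s ^ 2)) := by ring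
      _ ≤ ‖(y : ℂ) + Complex.I * s‖ * ‖(y : ℂ) + Complex.I * s‖ ^ 2 := by
        rw [h2]
        gcongr
      _ = _ := by ring

open scoped FourierTransform in
/-- Fourier inversion for `t² e^{-yt}` on the half-line. -/
theorem integral_exp_div_cube {y : ℝ} (hy : 0 < y) (u : ℝ) :
    ∫ s : ℝ, Complex.exp (Complex.I * u * s) / ((y : ℂ) + Complex.I * s) ^ 3
      = Real.pi * cubeKernel y u := by
  have hF : 𝓕 (cubeKernel y) =
      fun w : ℝ => 2 / ((y : ℂ) + Complex.I * (2 * Real.pi * w : ℝ)) ^ 3 :=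
    funext (fourier_cubeKernel hy)
  have hint : Integrable (𝓕 (cubeKernel y)) := by
    rw [hF]
    simpa only [div_eq_mul_inv] using
      ((integrable_inv_cube hy).comp_mul_left' Real.two_pi_pos.ne').const_mul 2
  have h := congrFun
    ((continuous_cubeKernel y).fourierInv_fourier_eq (integrable_cubeKernel hy) hint) u
  rw [Real.fourierInv_eq', hF] at h
  have hs := Measure.integral_comp_mul_left
    (fun s : ℝ => Complex.exp (Complex.I * u * s) / ((y : ℂ) + Complex.I * s) ^ 3)
    (2 * Real.pi)
  have h2 : cubeKernel y u = 2 * ∫ w : ℝ, Complex.exp (Complex.I * u * (2 * Real.pi * w : ℝ)) /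
      ((y : ℂ) + Complex.I * (2 * Real.pi * w : ℝ)) ^ 3 := by
    rw [← h, ← integral_const_mul]
    congr 1 with w
    rw [smul_eq_mul, mul_div_assoc', mul_div_assoc', mul_comm 2 (Complex.exp _)]
    congr 3
    simp
    ring
  rw [h2, hs, abs_of_pos (inv_pos.2 Real.two_pi_pos), Complex.real_smul]
  push_cast
  field_simp

/-- For `m ∈ ℤ` and `z` in the lower half-plane, the integral of `e^{im(z+s)}/(z+s)³`
along the horizontal line through `z` equals `-iπm²` for `m > 0` and `0` for `m ≤ 0`. -/
theorem stmt_3 (m : ℤ) (z : ℂ) (hz : z.im < 0) :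
    Integrable (fun s : ℝ => Complex.exp (Complex.I * m * (z + s)) / (z + s) ^ 3) ∧
    ∫ s : ℝ, Complex.exp (Complex.I * m * (z + s)) / (z + s) ^ 3
      = if 0 < m then -Complex.I * (Real.pi : ℂ) * (m : ℂ) ^ 2 else 0 := by
  obtain ⟨y, hy, hzy⟩ : ∃ y : ℝ, 0 < y ∧ z = z.re - Complex.I * y :=
    ⟨-z.im, by linarith, by apply Complex.ext <;> simp⟩
  set f : ℝ → ℂ := fun s =>
    Complex.exp (Complex.I * (m : ℝ) * s) / ((y : ℂ) + Complex.I * s) ^ 3 with hf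
  have hfi : Integrable f := by
    refine (integrable_inv_cube hy).mono (Measurable.aestronglyMeasurable (by fun_prop))
      (.of_forall fun s => ?_)
    simp only [hf]
    rw [div_eq_mul_inv, norm_mul,
      show Complex.I * (m : ℝ) * s = ((m * s : ℝ) : ℂ) * Complex.I by push_cast; ring,
      Complex.norm_exp_ofReal_mul_I, one_mul]
  have hfun : (fun s : ℝ => Complex.exp (Complex.I * m * (z + s)) / (z + s) ^ 3) =
      fun s : ℝ => -Complex.I * Complex.exp (m * y) * f (s + z.re) := by
    ext s
    have h1 : z + s = -Complex.I * (y + Complex.I * (s + z.re : ℝ)) := by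
      conv_lhs => rw [hzy]
      push_cast
      linear_combination ((s : ℂ) + z.re) * Complex.I_sq
    have h2 : Complex.I * m * (z + s) = m * y + Complex.I * (m : ℝ) * (s + z.re : ℝ) := by
      conv_lhs => rw [hzy]
      push_cast
      linear_combination (-(m : ℂ) * y) * Complex.I_sq
    have h3 : (-Complex.I) ^ 3 = Complex.I := by
      linear_combination (-Complex.I) * Complex.I_sq
    rw [h2, h1, Complex.exp_add, mul_pow, h3, hf, mul_comm Complex.I (_ ^ 3), ← div_div,
      Complex.div_I]
    ring
  rw [hfun]
  refine ⟨(hfi.comp_add_right z.re).const_mul _, ?_⟩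
  rw [integral_const_mul, integral_add_right_eq_self f, hf, integral_exp_div_cube hy]
  split_ifs with hm
  · have hm' : (0 : ℝ) ≤ m := by exact_mod_cast hm.le
    have he : Complex.exp (m * y) * Complex.exp (-y * m) = 1 := by
      rw [← Complex.exp_add]
      ring_nf
      exact Complex.exp_zero
    rw [cubeKernel, max_eq_left hm']
    push_cast
    linear_combination (-Complex.I * Real.pi * m ^ 2) * he
  · have hm' : (m : ℝ) ≤ 0 := by exact_mod_cast not_lt.1 hm
    simp [cubeKernel, max_eq_right hm']
end

section
/- For every real number ω ≠ 0, the function r ↦ (2 sinh r / cosh³ r)·e^{iωr} is integrable on ℝ and ∫_{−∞}^{∞} (2 sinh r / cosh³ r)·e^{iωr} dr = iπω² / sinh(πω/2). -/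
open MeasureTheory

lemma Real.sigmoid_two_mul (r : ℝ) :
    Real.sigmoid (2 * r) = Real.exp r / (2 * Real.cosh r) := by
  have h : Real.exp (-(2 * r)) = Real.exp (-r) / Real.exp r := by
    rw [← Real.exp_sub]; ring_nf
  have h₁ := Real.exp_pos r
  have h₂ := Real.exp_pos (-r)
  rw [Real.sigmoid_def, h, Real.cosh_eq]
  field_simp

lemma Real.one_sub_sigmoid_two_mul (r : ℝ) :
    1 - Real.sigmoid (2 * r) = Real.exp (-r) / (2 * Real.cosh r) := by
  rw [← Real.sigmoid_neg, ← mul_neg, Real.sigmoid_two_mul, Real.cosh_neg]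

lemma Real.hasDerivAt_sigmoid_two_mul (r : ℝ) :
    HasDerivAt (fun r => Real.sigmoid (2 * r)) (1 / (2 * Real.cosh r ^ 2)) r := by
  have h := (Real.hasDerivAt_sigmoid (2 * r)).comp r ((hasDerivAt_id r).const_mul 2)
  refine h.congr_deriv ?_
  rw [Real.one_sub_sigmoid_two_mul, Real.sigmoid_two_mul]
  have hc := Real.cosh_pos r
  have he : Real.exp r * Real.exp (-r) = 1 := by rw [← Real.exp_add]; simp
  field_simp
  linear_combination he

lemma Real.image_sigmoid_two_mul :
    (fun r => Real.sigmoid (2 * r)) '' Set.univ = Set.Ioo 0 1 := by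
  rw [Set.image_univ, ← Real.range_sigmoid]
  exact (mul_left_surjective₀ two_ne_zero).range_comp Real.sigmoid

lemma Real.injective_sigmoid_two_mul :
    Function.Injective (fun r => Real.sigmoid (2 * r)) :=
  Real.sigmoid_injective.comp (mul_right_injective₀ two_ne_zero)

lemma integrable_inv_cosh_sq : Integrable (fun r : ℝ => 1 / Real.cosh r ^ 2) := by
  have h := (integrableOn_image_iff_integrableOn_abs_deriv_smul MeasurableSet.univ
    (fun r _ => (Real.hasDerivAt_sigmoid_two_mul r).hasDerivWithinAt)
    Real.injective_sigmoid_two_mul.injOn (fun _ => (1 : ℝ))).1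
    (by rw [Real.image_sigmoid_two_mul]; simp)
  rw [integrableOn_univ] at h
  refine (h.const_mul 2).congr (.of_forall fun r => ?_)
  have hc := Real.cosh_pos r
  simp only [smul_eq_mul, mul_one]
  rw [abs_of_pos (by positivity)]
  field_simp

lemma Complex.norm_exp_I_mul_mul_ofReal (ω r : ℝ) : ‖Complex.exp (Complex.I * ω * r)‖ = 1 := by
  rw [show Complex.I * ω * r = ((ω * r : ℝ) : ℂ) * Complex.I by push_cast; ring]
  exact Complex.norm_exp_ofReal_mul_I _

lemma integrable_ofReal_mul_exp_I {f : ℝ → ℝ} (hf : Integrable f) (ω : ℝ) :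
    Integrable (fun r : ℝ => (f r : ℂ) * Complex.exp (Complex.I * ω * r)) :=
  hf.ofReal.mul_bdd (c := 1) (by fun_prop)
    (.of_forall fun r => (Complex.norm_exp_I_mul_mul_ofReal ω r).le)

lemma integrable_sinh_div_cosh_cube :
    Integrable (fun r : ℝ => 2 * Real.sinh r / Real.cosh r ^ 3) := by
  refine (integrable_inv_cosh_sq.const_mul 2).mono'
    (Continuous.aestronglyMeasurable ?_) (.of_forall fun r => ?_)
  · exact (continuous_const.mul Real.continuous_sinh).div (Real.continuous_cosh.pow 3)
      fun r => pow_ne_zero 3 (Real.cosh_pos r).ne'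
  · have hc := Real.cosh_pos r
    have hs : |Real.sinh r| ≤ Real.cosh r :=
      abs_le_of_sq_le_sq (by rw [Real.cosh_sq]; linarith) hc.le
    rw [Real.norm_eq_abs, abs_div, abs_mul, abs_two, abs_of_pos (pow_pos hc 3)]
    calc 2 * |Real.sinh r| / Real.cosh r ^ 3 ≤ 2 * Real.cosh r / Real.cosh r ^ 3 := by gcongr
      _ = 2 * (1 / Real.cosh r ^ 2) := by field_simp

lemma Complex.sigmoid_two_mul_cpow_mul_one_sub_cpow (s : ℂ) (r : ℝ) :
    (Real.sigmoid (2 * r) : ℂ) ^ s * (1 - (Real.sigmoid (2 * r) : ℂ)) ^ (-s)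
      = Complex.exp (2 * s * r) := by
  have hc := Real.cosh_pos r
  have h₀ := Real.sigmoid_pos (2 * r)
  have h₁ := sub_pos.2 (Real.sigmoid_lt_one (2 * r))
  have hlog : Real.log (Real.sigmoid (2 * r)) - Real.log (1 - Real.sigmoid (2 * r)) = 2 * r := by
    rw [Real.one_sub_sigmoid_two_mul, Real.sigmoid_two_mul,
      Real.log_div (Real.exp_ne_zero _) (by positivity),
      Real.log_div (Real.exp_ne_zero _) (by positivity), Real.log_exp, Real.log_exp]
    ring
  have hlog' := congrArg Complex.ofReal hlog
  rw [← Complex.ofReal_one, ← Complex.ofReal_sub,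
    Complex.cpow_def_of_ne_zero (by exact_mod_cast h₀.ne'),
    Complex.cpow_def_of_ne_zero (by exact_mod_cast h₁.ne'),
    ← Complex.ofReal_log h₀.le, ← Complex.ofReal_log h₁.le, ← Complex.exp_add]
  push_cast at hlog' ⊢
  congr 1
  linear_combination s * hlog'

lemma integral_inv_cosh_sq_mul_exp_eq_betaIntegral (s : ℂ) :
    ∫ r : ℝ, ((1 / Real.cosh r ^ 2 : ℝ) : ℂ) * Complex.exp (2 * s * r)
      = 2 * Complex.betaIntegral (1 + s) (1 - s) := by
  have h := integral_image_eq_integral_abs_deriv_smul MeasurableSet.univ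
    (fun r _ => (Real.hasDerivAt_sigmoid_two_mul r).hasDerivWithinAt)
    Real.injective_sigmoid_two_mul.injOn
    (fun x : ℝ => (x : ℂ) ^ (1 + s - 1) * (1 - (x : ℂ)) ^ (1 - s - 1))
  rw [Real.image_sigmoid_two_mul, ← integral_Ioc_eq_integral_Ioo,
    ← intervalIntegral.integral_of_le zero_le_one, setIntegral_univ] at h
  rw [Complex.betaIntegral, h, ← integral_const_mul]
  refine integral_congr_ae (.of_forall fun r => ?_)
  have hc := Real.cosh_pos r
  have hc' : (Real.cosh r : ℂ) ≠ 0 := by exact_mod_cast hc.ne'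
  simp only [add_sub_cancel_left, sub_sub_cancel_left]
  rw [Complex.sigmoid_two_mul_cpow_mul_one_sub_cpow, abs_of_pos (by positivity),
    Complex.real_smul, ← mul_assoc]
  congr 1
  push_cast at hc' ⊢
  field_simp

lemma integral_inv_cosh_sq_mul_exp (ω : ℝ) (hω : ω ≠ 0) :
    ∫ r : ℝ, ((1 / Real.cosh r ^ 2 : ℝ) : ℂ) * Complex.exp (Complex.I * ω * r)
      = Real.pi * ω / ((Real.sinh (Real.pi * ω / 2) : ℝ) : ℂ) := by
  have hs : Complex.I * ω / 2 ≠ 0 := by simp [hω]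
  have h := integral_inv_cosh_sq_mul_exp_eq_betaIntegral (Complex.I * ω / 2)
  rw [mul_div_cancel₀ _ two_ne_zero] at h
  rw [h, Complex.betaIntegral_eq_Gamma_mul_div _ _ (by simp) (by simp),
    add_comm 1 (Complex.I * ω / 2), Complex.Gamma_add_one _ hs, mul_assoc,
    Complex.Gamma_mul_Gamma_one_sub,
    show (Real.pi : ℂ) * (Complex.I * ω / 2) = (Real.pi * ω / 2 : ℂ) * Complex.I by ring,
    Complex.sin_mul_I,
    show Complex.I * ω / 2 + 1 + (1 - Complex.I * ω / 2) = 2 by ring,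
    Complex.Gamma_ofNat_eq_factorial]
  push_cast
  have hsinh : Complex.sinh (Real.pi * ω / 2) ≠ 0 := by
    have : Real.sinh (Real.pi * ω / 2) ≠ 0 := by
      simp [Real.sinh_eq_zero, hω, Real.pi_ne_zero]
    exact_mod_cast this
  simp
  field_simp

lemma hasDerivAt_inv_cosh_sq (r : ℝ) :
    HasDerivAt (fun r => 1 / Real.cosh r ^ 2) (-(2 * Real.sinh r / Real.cosh r ^ 3)) r := by
  have hc := Real.cosh_pos r
  refine ((hasDerivAt_const r (1 : ℝ)).div ((Real.hasDerivAt_cosh r).pow 2)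
    (pow_ne_zero 2 hc.ne')).congr_deriv ?_
  simp only [Pi.pow_apply]
  field_simp
  ring

/-- Fourier transform identity: for `ω ≠ 0`,
`∫ (2 sinh r / cosh³ r) e^{iωr} dr = iπω² / sinh(πω/2)`. -/
theorem stmt_4 (ω : ℝ) (hω : ω ≠ 0) :
    Integrable (fun r : ℝ =>
      ((2 * Real.sinh r / (Real.cosh r) ^ 3 : ℝ) : ℂ) * Complex.exp (Complex.I * ω * r)) ∧
    ∫ r : ℝ, ((2 * Real.sinh r / (Real.cosh r) ^ 3 : ℝ) : ℂ) * Complex.exp (Complex.I * ω * r)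
      = Complex.I * (Real.pi : ℂ) * (ω : ℂ) ^ 2 / ((Real.sinh (Real.pi * ω / 2) : ℝ) : ℂ) := by
  have hint := integrable_ofReal_mul_exp_I integrable_sinh_div_cosh_cube ω
  have hsech := integrable_ofReal_mul_exp_I integrable_inv_cosh_sq ω
  refine ⟨hint, ?_⟩
  have hexp (r : ℝ) : HasDerivAt (fun r : ℝ => Complex.exp (Complex.I * ω * r))
      (Complex.exp (Complex.I * ω * r) * (Complex.I * ω)) r := by
    simpa using ((Complex.ofRealCLM.hasDerivAt (x := r)).const_mul (Complex.I * ω)).cexp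
  have hparts := integral_mul_deriv_eq_deriv_mul_of_integrable
    (fun r _ => (hasDerivAt_inv_cosh_sq r).ofReal_comp) (fun r _ => hexp r)
    ((hsech.mul_const (Complex.I * ω)).congr (.of_forall fun r => mul_assoc _ _ _))
    (hint.neg.congr (.of_forall fun r => by simp)) hsech
  simp only [Complex.ofReal_neg, neg_mul, integral_neg, neg_neg] at hparts
  rw [← hparts]
  simp only [← mul_assoc _ (Complex.exp _) (Complex.I * ω)]
  rw [integral_mul_const, integral_inv_cosh_sq_mul_exp ω hω]
  ring
end

section
/- Let (g_k)_{k∈ℤ} be complex numbers with |g_k| ≤ C·e^{−σ|k|} for some C, σ > 0, and set g(τ) = Σ_{k∈ℤ} g_k e^{ikτ}. Then for every z ∈ ℂ with Im z < 0 and every τ ∈ ℝ, the function t ↦ g(τ + t)/(z + t)² is integrable on ℝ, the series Σ_{k≥1} 4πk·g_k·e^{ik(τ − z)} converges absolutely, and −2·∫_{−∞}^{∞} g(τ + t)/(z + t)² dt = Σ_{k=1}^{∞} 4πk·g_k·e^{ik(τ − z)}. In particular, the coefficient of e^{iτ} in this expansion is 4π·g₁·e^{−iz}, so that e^{iz} times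 the first Fourier coefficient in τ of the left-hand side equals 4π·g₁. -/
open MeasureTheory

open Set Filter Topology FourierTransform

/-- The integrand of the complex Laplace transform of `x ↦ x` is integrable on `(0, ∞)`. -/
lemma integrableOn_ofReal_mul_cexp_neg_mul_Ioi {b : ℂ} (hb : 0 < b.re) :
    IntegrableOn (fun x : ℝ => (x : ℂ) * Complex.exp (-b * x)) (Ioi 0) := by
  have h := integrableOn_rpow_mul_exp_neg_mul_rpow (s := 1) (p := 1) (by norm_num) one_pos hb
  refine Integrable.mono' h (Continuous.aestronglyMeasurable (by fun_prop)) ?_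
  filter_upwards [ae_restrict_mem measurableSet_Ioi] with x hx
  rw [norm_mul, Complex.norm_exp, Complex.norm_real, Real.norm_of_nonneg (le_of_lt hx)]
  simp

/-- The complex Laplace transform of `x ↦ x`. -/
lemma integral_ofReal_mul_cexp_neg_mul_Ioi {b : ℂ} (hb : 0 < b.re) :
    ∫ x : ℝ in Ioi 0, (x : ℂ) * Complex.exp (-b * x) = 1 / b ^ 2 := by
  have hb0 : b ≠ 0 := by rintro rfl; simp at hb
  have hderiv : ∀ x : ℝ, HasDerivAt
      (fun x : ℝ => -((x : ℂ) / b + 1 / b ^ 2) * Complex.exp (-b * x))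
      ((x : ℂ) * Complex.exp (-b * x)) x := by
    intro x
    have h1 : HasDerivAt (fun x : ℝ => (x : ℂ)) 1 x := Complex.ofRealCLM.hasDerivAt
    have h2 := (((h1.div_const b).add_const (1 / b ^ 2)).neg).mul ((h1.const_mul (-b)).cexp)
    refine h2.congr_deriv ?_
    simp only [Pi.neg_apply]
    field_simp
    ring
  have h0 : Tendsto (fun x : ℝ => Complex.exp (-b * x)) atTop (𝓝 0) := by
    rw [tendsto_zero_iff_norm_tendsto_zero]
    have := tendsto_rpow_mul_exp_neg_mul_atTop_nhds_zero 0 b.re hb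
    simpa [Complex.norm_exp] using this
  have h1 : Tendsto (fun x : ℝ => (x : ℂ) * Complex.exp (-b * x)) atTop (𝓝 0) := by
    rw [tendsto_zero_iff_norm_tendsto_zero]
    have := (tendsto_rpow_mul_exp_neg_mul_atTop_nhds_zero 1 b.re hb).norm
    simpa [Complex.norm_exp, abs_mul] using this
  have hlim : Tendsto (fun x : ℝ => -((x : ℂ) / b + 1 / b ^ 2) * Complex.exp (-b * x))
      atTop (𝓝 0) := by
    have := (h1.const_mul (-(1 / b))).sub (h0.const_mul (1 / b ^ 2))
    simp only [mul_zero, sub_zero] at this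
    refine this.congr fun x => ?_
    ring
  rw [integral_Ioi_of_hasDerivAt_of_tendsto' (fun x _ => hderiv x)
    (integrableOn_ofReal_mul_cexp_neg_mul_Ioi hb) hlim]
  simp

lemma add_ofReal_ne_zero_of_im_neg {z : ℂ} (hz : z.im < 0) (t : ℝ) : z + t ≠ 0 := by
  intro h
  have := congrArg Complex.im h
  simp at this
  exact hz.ne this

/-- The double pole `1 / (z + t)²` off the real axis is integrable in `t`. -/
lemma integrable_one_div_add_ofReal_sq {z : ℂ} (hz : z.im < 0) :
    Integrable (fun t : ℝ => 1 / (z + t) ^ 2) := by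
  have hy : -z.im ≠ 0 := by linarith
  have h := ((integrable_inv_one_add_sq.comp_mul_left' (inv_ne_zero hy)).comp_add_left
    z.re).const_mul ((z.im ^ 2)⁻¹)
  refine h.mono' (Continuous.aestronglyMeasurable ?_) (Eventually.of_forall fun t => le_of_eq ?_)
  · exact continuous_const.div (by fun_prop)
      fun t => pow_ne_zero 2 (add_ofReal_ne_zero_of_im_neg hz t)
  · rw [norm_div, norm_one, norm_pow, ← Complex.normSq_eq_norm_sq, Complex.normSq_apply,
      one_div, ← mul_inv]
    congr 1
    simp
    field_simp [hz.ne]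
    ring

/-- The Fourier transform of the double pole `1 / (z + t)²`, for `z` in the lower half plane. -/
lemma integral_cexp_div_add_ofReal_sq {z : ℂ} (hz : z.im < 0) (k : ℝ) :
    ∫ t : ℝ, Complex.exp (Complex.I * k * t) / (z + t) ^ 2
      = -(2 * Real.pi * (max k 0 : ℝ) * Complex.exp (-Complex.I * k * z)) := by
  set f : ℝ → ℂ := fun x => ((max x 0 : ℝ) : ℂ) * Complex.exp (-(Complex.I * z) * x) with hf
  have hre : 0 < (Complex.I * z).re := by simpa using hz
  have hf_ind : f = (Ioi 0).indicator
      (fun x : ℝ => (x : ℂ) * Complex.exp (-(Complex.I * z) * x)) := by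
    ext x
    rcases le_or_gt x 0 with h | h
    · simp [hf, h]
    · simp [hf, h, h.le]
  have hf_int : Integrable f := by
    rw [hf_ind, integrable_indicator_iff measurableSet_Ioi]
    exact integrableOn_ofReal_mul_cexp_neg_mul_Ioi hre
  have hf_cont : Continuous f := by fun_prop
  have hfour : 𝓕 f = fun w : ℝ => -(1 / (z + (2 * Real.pi * w : ℝ)) ^ 2) := by
    ext w
    have hre' : 0 < (Complex.I * (z + (2 * Real.pi * w : ℝ))).re := by simpa using hz
    have key := integral_ofReal_mul_cexp_neg_mul_Ioi hre'
    rw [mul_pow, Complex.I_sq] at key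
    rw [Real.fourier_real_eq_integral_exp_smul,
      show -(1 / (z + (2 * Real.pi * w : ℝ)) ^ 2)
        = 1 / (-1 * (z + (2 * Real.pi * w : ℝ)) ^ 2) by rw [neg_one_mul, div_neg], ← key,
      ← integral_indicator measurableSet_Ioi]
    congr 1
    ext x
    rcases le_or_gt x 0 with h | h
    · simp [hf_ind, h]
    · simp only [hf_ind, mem_Ioi, h, indicator_of_mem, smul_eq_mul]
      rw [mul_left_comm, ← Complex.exp_add]
      congr 2
      push_cast
      ring
  have hfour_int : Integrable (𝓕 f) := by
    rw [hfour]
    exact ((integrable_one_div_add_ofReal_sq hz).comp_mul_left' (R := 2 * Real.pi)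
      (by positivity)).neg
  have hinv := congrFun (hf_cont.fourierInv_fourier_eq hf_int hfour_int) k
  rw [hfour, Real.fourierInv_eq'] at hinv
  have hcv := Measure.integral_comp_mul_left
    (fun t : ℝ => Complex.exp (Complex.I * k * t) / (z + t) ^ 2) (2 * Real.pi)
  have hpi : (0 : ℝ) < 2 * Real.pi := by positivity
  rw [abs_of_pos (inv_pos.2 hpi), eq_inv_smul_iff₀ hpi.ne'] at hcv
  rw [← hcv]
  have hneg : ∫ w : ℝ, Complex.exp (Complex.I * k * (2 * Real.pi * w : ℝ))
      / (z + (2 * Real.pi * w : ℝ)) ^ 2 = -f k := by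
    rw [← hinv, ← integral_neg]
    congr 1
    ext w
    rw [smul_eq_mul, mul_neg, neg_neg, mul_one_div]
    congr 2
    simp
    ring
  rw [hneg, hf]
  simp only [Complex.real_smul]
  push_cast
  rw [show -(Complex.I * z) * (k : ℂ) = -Complex.I * k * z by ring]
  ring

/-- The first Fourier coefficient of an absolutely convergent series `∑_{k ≥ 1} c_k e^{ikτ}`. -/
lemma integral_tsum_cexp_mul_cexp_neg {c : ℕ → ℂ} (hc : Summable fun k => ‖c k‖) :
    ∫ τ in (0 : ℝ)..(2 * Real.pi),
      (∑' k : ℕ, c k * Complex.exp (Complex.I * ((k : ℂ) + 1) * τ)) *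
        Complex.exp (-Complex.I * (τ : ℂ)) = 2 * Real.pi * c 0 := by
  have hpi : (0 : ℝ) ≤ 2 * Real.pi := by positivity
  have hterm : ∀ τ : ℝ, (∑' k : ℕ, c k * Complex.exp (Complex.I * ((k : ℂ) + 1) * τ)) *
      Complex.exp (-Complex.I * (τ : ℂ)) = ∑' k : ℕ, c k * Complex.exp (Complex.I * k * τ) := by
    intro τ
    rw [← tsum_mul_right]
    congr 1
    ext k
    rw [mul_assoc, ← Complex.exp_add]
    congr 2
    ring
  have hnorm : ∀ (k : ℕ) (τ : ℝ), ‖c k * Complex.exp (Complex.I * k * τ)‖ = ‖c k‖ := by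
    intro k τ
    rw [norm_mul, Complex.norm_exp]
    simp
  have hsum : HasSum (fun k : ℕ => ∫ τ in (0 : ℝ)..(2 * Real.pi),
      c k * Complex.exp (Complex.I * k * τ))
      (∫ τ in (0 : ℝ)..(2 * Real.pi), ∑' k : ℕ, c k * Complex.exp (Complex.I * k * τ)) := by
    simp only [intervalIntegral.integral_of_le hpi]
    refine hasSum_integral_of_summable_integral_norm (fun k => ?_) ?_
    · exact (Continuous.intervalIntegrable (by fun_prop) _ _).1
    · simp only [hnorm]
      simpa using hc.mul_left _
  simp only [hterm]
  refine hsum.unique ?_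
  convert hasSum_single (0 : ℕ) ?_ using 1
  · simp
  · intro k hk
    have hk' : Complex.I * (k : ℂ) ≠ 0 := by simpa using hk
    rw [intervalIntegral.integral_const_mul, integral_exp_mul_complex hk',
      show Complex.I * (k : ℂ) * ((2 * Real.pi : ℝ) : ℂ) = (k : ℤ) * (2 * Real.pi * Complex.I) by
        push_cast; ring, Complex.exp_int_mul_two_pi_mul_I]
    simp

lemma summable_norm_of_exponential_decay {g : ℤ → ℂ} {C σ : ℝ} (hσ : 0 < σ)
    (hdecay : ∀ k : ℤ, ‖g k‖ ≤ C * Real.exp (-σ * |(k : ℝ)|)) : Summable fun k => ‖g k‖ := by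
  refine Summable.of_nonneg_of_le (fun _ => norm_nonneg _) hdecay (Summable.mul_left _ ?_)
  have h : Summable fun n : ℕ => Real.exp (-σ * n) := by
    simpa [mul_comm] using Real.summable_exp_nat_mul_iff.2 (neg_lt_zero.2 hσ)
  exact Summable.of_nat_of_neg (by simpa using h) (by simpa using h)

/-- An absolutely convergent Fourier series may be integrated termwise against the double pole
`1 / (z + t)²`; only the positive frequencies contribute. -/
lemma integral_fourierSeries_div_add_ofReal_sq {g : ℤ → ℂ} (hg : Summable fun k => ‖g k‖)
    {z : ℂ} (hz : z.im < 0) (τ : ℝ) :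
    -2 * ∫ t : ℝ, (∑' k : ℤ, g k * Complex.exp (Complex.I * k * (τ + t : ℝ))) / (z + t) ^ 2
      = ∑' k : ℕ, (4 * (Real.pi : ℂ) * ((k : ℂ) + 1)) * g ((k : ℤ) + 1) *
          Complex.exp (Complex.I * ((k : ℂ) + 1) * ((τ : ℂ) - z)) := by
  set F : ℤ → ℝ → ℂ := fun k t =>
    g k * Complex.exp (Complex.I * k * (τ + t : ℝ)) / (z + t) ^ 2 with hF
  have hnorm : ∀ k t, ‖F k t‖ = ‖g k‖ * ‖1 / (z + (t : ℂ)) ^ 2‖ := by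
    intro k t
    have : ‖Complex.exp (Complex.I * k * (τ + t : ℝ))‖ = 1 := by
      rw [Complex.norm_exp]; simp
    rw [hF]
    simp only [norm_div, norm_mul, this, mul_one, norm_one]
    ring
  have hF_int : ∀ k, Integrable (F k) := by
    intro k
    refine ((integrable_one_div_add_ofReal_sq hz).norm.const_mul ‖g k‖).mono'
      (Continuous.aestronglyMeasurable ?_) (Eventually.of_forall fun t => (hnorm k t).le)
    exact Continuous.div (by fun_prop) (by fun_prop)
      fun t => pow_ne_zero 2 (add_ofReal_ne_zero_of_im_neg hz t)
  have hsum := hasSum_integral_of_summable_integral_norm hF_int (by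
    simp only [hnorm, integral_const_mul]
    exact hg.mul_right _)
  have hval : ∀ k : ℤ, ∫ t, F k t
      = -(2 * Real.pi * (max (k : ℝ) 0 : ℝ)) * g k *
        Complex.exp (Complex.I * k * ((τ : ℂ) - z)) := by
    intro k
    have h := integral_cexp_div_add_ofReal_sq hz k
    have hFk : F k = fun t : ℝ => (g k * Complex.exp (Complex.I * k * τ)) *
        (Complex.exp (Complex.I * (k : ℝ) * t) / (z + t) ^ 2) := by
      ext t
      rw [hF, mul_div_assoc', mul_assoc (g k), ← Complex.exp_add]
      push_cast
      simp only [mul_add]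
    rw [hFk, integral_const_mul, h,
      show Complex.I * (k : ℂ) * ((τ : ℂ) - z)
        = Complex.I * k * τ + -Complex.I * (k : ℝ) * z by push_cast; ring, Complex.exp_add]
    ring
  simp only [hval] at hsum
  have hinj : Function.Injective fun k : ℕ => (k : ℤ) + 1 := fun a b h => by simpa using h
  rw [← hinj.hasSum_iff] at hsum
  · have h2 := (hsum.mul_left (-2)).tsum_eq
    simp only [hF, tsum_div_const] at h2
    rw [← h2]
    refine tsum_congr fun k => ?_
    have : max ((k : ℝ) + 1) 0 = (k : ℝ) + 1 := max_eq_left (by positivity)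
    simp only [Function.comp_apply]
    push_cast
    rw [this]
    push_cast
    ring
  · intro k hk
    have hk0 : k ≤ 0 := by
      by_contra! h
      exact hk ⟨(k - 1).toNat, by simp only; omega⟩
    have : max (k : ℝ) 0 = 0 := max_eq_right (by exact_mod_cast hk0)
    simp [this]

/-- An absolutely convergent Fourier series is integrable against the double pole
`1 / (z + t)²`. -/
lemma integrable_fourierSeries_div_add_ofReal_sq {g : ℤ → ℂ} (hg : Summable fun k => ‖g k‖)
    {z : ℂ} (hz : z.im < 0) (τ : ℝ) :
    Integrable fun t : ℝ =>
      (∑' k : ℤ, g k * Complex.exp (Complex.I * k * (τ + t : ℝ))) / (z + t) ^ 2 := by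
  have hnorm : ∀ (k : ℤ) (t : ℝ), ‖g k * Complex.exp (Complex.I * k * (τ + t : ℝ))‖ = ‖g k‖ := by
    intro k t
    rw [norm_mul, Complex.norm_exp]
    simp
  have hcont : Continuous fun t : ℝ =>
      ∑' k : ℤ, g k * Complex.exp (Complex.I * k * (τ + t : ℝ)) :=
    continuous_tsum (fun k => by fun_prop) hg fun k t => (hnorm k t).le
  have h := (integrable_one_div_add_ofReal_sq hz).bdd_mul (c := ∑' k, ‖g k‖)
    hcont.aestronglyMeasurable (Eventually.of_forall fun t => ?_)
  · simpa only [mul_one_div] using h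
  · exact tsum_of_norm_bounded hg.hasSum fun k => (hnorm k t).le

/-- Summability of the positive-frequency coefficients `4πk g_k e^{ik(τ - z)}`. -/
lemma summable_norm_mul_cexp_of_im_neg {g : ℤ → ℂ} (hg : Summable fun k => ‖g k‖)
    {z : ℂ} (hz : z.im < 0) (τ : ℝ) :
    Summable (fun k : ℕ =>
      ‖(4 * (Real.pi : ℂ) * ((k : ℂ) + 1)) * g ((k : ℤ) + 1) *
        Complex.exp (Complex.I * ((k : ℂ) + 1) * ((τ : ℂ) - z))‖) := by
  have hinj : Function.Injective fun k : ℕ => (k : ℤ) + 1 := fun a b h => by simpa using h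
  have hbdd : ∀ x : ℝ, x * Real.exp (x * z.im) ≤ 1 / -z.im := by
    intro x
    have h := Real.add_one_le_exp (x * -z.im)
    rw [le_div_iff₀ (by linarith), show x * z.im = -(x * -z.im) by ring, Real.exp_neg,
      mul_right_comm, ← div_eq_mul_inv, div_le_one (Real.exp_pos _)]
    linarith
  refine Summable.of_nonneg_of_le (fun _ => norm_nonneg _) (fun k => ?_)
    ((hg.comp_injective hinj).mul_left (4 * Real.pi * (1 / -z.im)))
  have hk : ‖(k : ℂ) + 1‖ = (k : ℝ) + 1 := by
    exact_mod_cast Complex.norm_natCast (k + 1)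
  have hexp : ‖Complex.exp (Complex.I * ((k : ℂ) + 1) * ((τ : ℂ) - z))‖
      = Real.exp (((k : ℝ) + 1) * z.im) := by
    rw [Complex.norm_exp]
    simp
  rw [norm_mul, norm_mul, norm_mul, norm_mul, hk, hexp, Complex.norm_real,
    Real.norm_of_nonneg Real.pi_pos.le, Complex.norm_ofNat, Function.comp_apply]
  calc 4 * Real.pi * ((k : ℝ) + 1) * ‖g (k + 1)‖ * Real.exp (((k : ℝ) + 1) * z.im)
      = 4 * Real.pi * (((k : ℝ) + 1) * Real.exp (((k : ℝ) + 1) * z.im)) * ‖g (k + 1)‖ := by ring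
    _ ≤ _ := by gcongr; exact hbdd _

/-- For `G(τ) = Σ_k g_k e^{ikτ}` with exponentially decaying coefficients and `Im z < 0`,
`-2∫_ℝ G(τ+t)/(z+t)² dt = Σ_{k≥1} 4πk g_k e^{ik(τ-z)}`; in particular `e^{iz}` times the
first Fourier coefficient (in `τ`) of the left-hand side equals `4π g₁`. -/
theorem stmt_16 (g : ℤ → ℂ) (C σ : ℝ) (hC : 0 < C) (hσ : 0 < σ)
    (hdecay : ∀ k : ℤ, ‖g k‖ ≤ C * Real.exp (-σ * |(k : ℝ)|))
    (G : ℝ → ℂ)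
    (hG : G = fun τ : ℝ => ∑' k : ℤ, g k * Complex.exp (Complex.I * (k : ℂ) * (τ : ℂ))) :
    ∀ z : ℂ, z.im < 0 → ∀ τ : ℝ,
      Integrable (fun t : ℝ => G (τ + t) / (z + t) ^ 2) ∧
      Summable (fun k : ℕ =>
        ‖(4 * (Real.pi : ℂ) * ((k : ℂ) + 1)) * g ((k : ℤ) + 1) *
          Complex.exp (Complex.I * ((k : ℂ) + 1) * ((τ : ℂ) - z))‖) ∧
      (-2 * ∫ t : ℝ, G (τ + t) / (z + t) ^ 2
        = ∑' k : ℕ, (4 * (Real.pi : ℂ) * ((k : ℂ) + 1)) * g ((k : ℤ) + 1) *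
            Complex.exp (Complex.I * ((k : ℂ) + 1) * ((τ : ℂ) - z))) ∧
      (Complex.exp (Complex.I * z) *
          ((1 / (2 * (Real.pi : ℂ))) *
            ∫ τ' in (0 : ℝ)..(2 * Real.pi),
              (-2 * ∫ t : ℝ, G (τ' + t) / (z + t) ^ 2) *
                Complex.exp (-Complex.I * (τ' : ℂ)))
        = 4 * (Real.pi : ℂ) * g 1) := by
  intro z hz τ
  have hg := summable_norm_of_exponential_decay hσ hdecay
  subst hG
  have hformula := integral_fourierSeries_div_add_ofReal_sq hg hz
  refine ⟨integrable_fourierSeries_div_add_ofReal_sq hg hz τ,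
    summable_norm_mul_cexp_of_im_neg hg hz τ, hformula τ, ?_⟩
  have hcoeff := integral_tsum_cexp_mul_cexp_neg
    (c := fun k : ℕ => (4 * (Real.pi : ℂ) * ((k : ℂ) + 1)) * g ((k : ℤ) + 1) *
      Complex.exp (Complex.I * ((k : ℂ) + 1) * ((0 : ℝ) - z)))
    (summable_norm_mul_cexp_of_im_neg hg hz 0)
  have hsplit : ∀ τ' : ℝ, ∑' k : ℕ, (4 * (Real.pi : ℂ) * ((k : ℂ) + 1)) * g ((k : ℤ) + 1) *
      Complex.exp (Complex.I * ((k : ℂ) + 1) * ((τ' : ℂ) - z))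
      = ∑' k : ℕ, (4 * (Real.pi : ℂ) * ((k : ℂ) + 1)) * g ((k : ℤ) + 1) *
        Complex.exp (Complex.I * ((k : ℂ) + 1) * ((0 : ℝ) - z)) *
          Complex.exp (Complex.I * ((k : ℂ) + 1) * τ') := by
    intro τ'
    refine tsum_congr fun k => ?_
    rw [mul_assoc _ (Complex.exp _), ← Complex.exp_add]
    congr 2
    push_cast
    ring
  have hpi : (Real.pi : ℂ) ≠ 0 := by exact_mod_cast Real.pi_ne_zero
  have hexp : Complex.exp (Complex.I * z) * Complex.exp (-(Complex.I * z)) = 1 := by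
    rw [← Complex.exp_add, add_neg_cancel, Complex.exp_zero]
  simp only [hformula]
  rw [intervalIntegral.integral_congr fun τ' _ => by rw [hsplit τ'], hcoeff]
  simp only [Nat.cast_zero, zero_add, mul_one, Complex.ofReal_zero, zero_sub, mul_neg]
  field_simp
  linear_combination g 1 * hexp
end
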